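/- arXiv:2407.03780 — 5 statements merged into one kernel-verified Lean document; each statement's English description precedes it below -/
import Mathlib

section
/- Let X be a nonempty compact connected metric space and let f : X → X be a surjective covering map which is not injective. Then for every x ∈ X the fiber π^{-1}(x) ⊆ X_f is nonempty, compact, totally disconnected, and has no isolated points (in the subspace topology induced by the product topology on X^ℤ). -/
open Function Set

/-- The inverse limit (natural extension) of a map `f : X → X`, with the subspace
topology induced by the product topology on `X^ℤ`. -/
def InvLimit {X : Type*} (f : X → X) : Set (ℤ → X) :=
  {x | ∀ k : ℤ, f (x k) = x (k + 1)}

/-- The projection `π : X_f → X` onto the 0-th coordinate. -/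
def InvLimit.proj {X : Type*} (f : X → X) (x : InvLimit f) : X := x.1 0

/-- If a local homeomorphism from a compact Hausdorff space to a connected Hausdorff space is not
injective, then every point of the codomain has at least two preimages: the set of such points
is clopen. -/
theorem IsLocalHomeomorph.exists_ne_of_not_injective {X Y : Type*} [TopologicalSpace X]
    [T2Space X] [CompactSpace X] [TopologicalSpace Y] [T2Space Y] [PreconnectedSpace Y]
    {f : X → Y} (hf : IsLocalHomeomorph f) (hninj : ¬ Injective f) (y : Y) :
    ∃ a b, a ≠ b ∧ f a = y ∧ f b = y := by
  let D : Set (X × X) := {p | f p.1 = f p.2 ∧ p.1 ≠ p.2}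
  let B : Set Y := (fun p : X × X => f p.1) '' D
  have hD : IsClosed D := by
    rw [← isOpen_compl_iff, isOpen_iff_mem_nhds]
    rintro ⟨a, b⟩ hab
    by_cases h : f a = f b
    · obtain rfl : a = b := by
        by_contra hne
        exact hab ⟨h, hne⟩
      obtain ⟨U, hU, haU, hinj⟩ := hf.isLocallyInjective a
      filter_upwards [prod_mem_nhds (hU.mem_nhds haU) (hU.mem_nhds haU)] with p hp hpD
      exact hpD.2 (hinj hp.1 hp.2 hpD.1)
    · have hne : IsOpen {p : X × X | f p.1 ≠ f p.2} :=
        isOpen_ne_fun (hf.continuous.comp continuous_fst) (hf.continuous.comp continuous_snd)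
      filter_upwards [hne.mem_nhds h] with p hp hpD
      exact hp hpD.1
  have hBclosed : IsClosed B :=
    (hD.isCompact.image (hf.continuous.comp continuous_fst)).isClosed
  have hBopen : IsOpen B := by
    rw [isOpen_iff_mem_nhds]
    rintro _ ⟨⟨a, b⟩, ⟨h, hne⟩, rfl⟩
    obtain ⟨U, V, hU, hV, haU, hbV, hUV⟩ := t2_separation hne
    have hfb := hf.isOpenMap.image_mem_nhds (hV.mem_nhds hbV)
    rw [← h] at hfb
    filter_upwards [hf.isOpenMap.image_mem_nhds (hU.mem_nhds haU), hfb]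
    rintro z ⟨a', ha', rfl⟩ ⟨b', hb', hab'⟩
    exact ⟨(a', b'), ⟨hab'.symm, hUV.ne_of_mem ha' hb'⟩, rfl⟩
  have hBne : B.Nonempty := by
    simp only [Injective, not_forall] at hninj
    obtain ⟨a, b, h, hne⟩ := hninj
    exact ⟨f a, (a, b), ⟨h, hne⟩, rfl⟩
  have hy : y ∈ B := (IsClopen.eq_univ ⟨hBclosed, hBopen⟩ hBne) ▸ mem_univ y
  obtain ⟨⟨a, b⟩, ⟨h, hne⟩, rfl⟩ := hy
  exact ⟨a, b, hne, rfl, h.symm⟩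

namespace InvLimit

variable {X : Type*} {f : X → X}

theorem exists_apply_eq (hsurj : Surjective f) (m : ℤ) (b : X) :
    ∃ y : InvLimit f, y.1 m = b := by
  obtain ⟨g, hg⟩ := hsurj.hasRightInverse
  refine ⟨⟨fun k => f^[(k - m).toNat] (g^[(m - k).toNat] b), fun k => ?_⟩, by simp⟩
  beta_reduce
  rcases le_or_gt m k with h | h
  · rw [show (m - k).toNat = 0 by omega, show (m - (k + 1)).toNat = 0 by omega,
      show (k + 1 - m).toNat = (k - m).toNat + 1 by omega, iterate_succ_apply']
  · rw [show (k - m).toNat = 0 by omega, show (k + 1 - m).toNat = 0 by omega,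
      show (m - k).toNat = (m - (k + 1)).toNat + 1 by omega, iterate_succ_apply']
    exact hg _

theorem apply_eq_of_le {y z : InvLimit f} {m : ℤ} (h : y.1 m = z.1 m) {k : ℤ} (hk : m ≤ k) :
    y.1 k = z.1 k := by
  induction k, hk using Int.leInduction with
  | base => exact h
  | succ k _ ih => rw [← y.2 k, ← z.2 k, ih]

theorem ext_neg_nat {y z : InvLimit f} (h : ∀ n : ℕ, y.1 (-n) = z.1 (-n)) : y = z :=
  Subtype.ext <| funext fun k =>
    apply_eq_of_le (h k.natAbs) (by omega)

variable [TopologicalSpace X]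

theorem continuous_apply (k : ℤ) : Continuous fun y : InvLimit f => y.1 k :=
  (_root_.continuous_apply k).comp continuous_subtype_val

theorem isClosed [T2Space X] (hf : Continuous f) : IsClosed (InvLimit f) := by
  simp only [InvLimit, ← Set.iInter_ofPred]
  exact isClosed_iInter fun k =>
    isClosed_eq (hf.comp (_root_.continuous_apply k)) (_root_.continuous_apply (k + 1))

theorem isCompact_fiber [T2Space X] [CompactSpace X] (hf : Continuous f) (x : X) :
    IsCompact (proj f ⁻¹' {x}) := by
  have : CompactSpace (InvLimit f) := isCompact_iff_compactSpace.mp (isClosed hf).isCompact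
  exact (isClosed_singleton.preimage (continuous_apply 0)).isCompact

theorem isTotallyDisconnected_fiber (hcov : IsCoveringMap f) (x : X) :
    IsTotallyDisconnected (proj f ⁻¹' {x}) := by
  intro t htx ht y hy z hz
  refine ext_neg_nat fun n => ?_
  induction n generalizing y z with
  | zero => exact (htx hy).trans (htx hz).symm
  | succ n ih =>
    refine hcov.constOn_of_comp ht (continuous_apply (-(n + 1 : ℕ))).continuousOn ?_ hy hz
    intro u hu v hv
    have hk : (-((n + 1 : ℕ) : ℤ)) + 1 = -n := by push_cast; ring
    change f (u.1 _) = f (v.1 _)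
    rw [u.2, v.2, hk]
    exact ih hu hv

theorem preperfect_fiber (hsurj : Surjective f)
    (hf : ∀ y, ∃ a b, a ≠ b ∧ f a = y ∧ f b = y) (x : X) :
    Preperfect (proj f ⁻¹' {x}) := by
  intro y hy
  have hne (n : ℕ) : ∃ z : InvLimit f, z.1 (-n) = y.1 (-n) ∧ z ≠ y := by
    obtain ⟨a, b, hab, ha, hb⟩ := hf (y.1 (-n))
    obtain ⟨c, hc, hcy⟩ : ∃ c, f c = y.1 (-n) ∧ c ≠ y.1 (-n - 1) := by
      by_cases h : a = y.1 (-n - 1)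
      · exact ⟨b, hb, fun h' => hab (h.trans h'.symm)⟩
      · exact ⟨a, ha, h⟩
    obtain ⟨z, rfl⟩ := exists_apply_eq hsurj (-n - 1 : ℤ) c
    refine ⟨z, ?_, fun h => hcy (by rw [h])⟩
    rw [← hc, z.2, sub_add_cancel]
  choose z hz hzy using hne
  have hlim : Filter.Tendsto z Filter.atTop (nhds y) := by
    rw [tendsto_subtype_rng, tendsto_pi_nhds]
    intro k
    refine tendsto_const_nhds.congr' ?_
    filter_upwards [Filter.eventually_ge_atTop k.natAbs] with n hn
    exact (apply_eq_of_le (hz n) (by omega)).symm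
  rw [accPt_iff_frequently]
  refine hlim.frequently (Filter.Frequently.of_forall fun n => ⟨hzy n, ?_⟩)
  exact (apply_eq_of_le (hz n) (by omega)).trans hy

end InvLimit

/-- If `X` is a nonempty compact connected metric space and `f : X → X` is a surjective
covering map which is not injective, then every fiber `π^{-1}(x) ⊆ X_f` is nonempty,
compact, totally disconnected and has no isolated points. -/
theorem stmt3 {X : Type*} [MetricSpace X] [CompactSpace X] [ConnectedSpace X] [Nonempty X]
    (f : X → X) (hcov : IsCoveringMap f) (hsurj : Function.Surjective f)
    (hninj : ¬ Function.Injective f) (x : X) :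
    (InvLimit.proj f ⁻¹' {x}).Nonempty ∧ IsCompact (InvLimit.proj f ⁻¹' {x}) ∧
      IsTotallyDisconnected (InvLimit.proj f ⁻¹' {x}) ∧
      Preperfect (InvLimit.proj f ⁻¹' {x}) := by
  refine ⟨?_, InvLimit.isCompact_fiber hcov.continuous x,
    InvLimit.isTotallyDisconnected_fiber hcov x, InvLimit.preperfect_fiber hsurj
      (hcov.isLocalHomeomorph.exists_ne_of_not_injective hninj) x⟩
  exact InvLimit.exists_apply_eq hsurj 0 x
end

section
/- Let X be a nonempty compact metric space and f : X → X a continuous surjective map. For every nonempty open subset A of X_f there exist m ∈ ℕ and a nonempty open subset V of X such that π^{-1}(V) ⊆ f̃^{-m}(A). -/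
open Function Set

/-- The shift map `f̃ : X_f → X_f`, `(f̃ x̃)_k = x_{k+1}`. -/
def InvLimit.shift {X : Type*} (f : X → X) (x : InvLimit f) : InvLimit f :=
  ⟨fun k => x.1 (k + 1), fun k => x.2 (k + 1)⟩

theorem InvLimit.iterate_apply {X : Type*} {f : X → X} (x : InvLimit f) (k : ℤ) (n : ℕ) :
    f^[n] (x.1 k) = x.1 (k + n) := by
  induction n with
  | zero => simp
  | succ n ih => rw [iterate_succ_apply', ih, x.2, Nat.cast_succ, add_assoc]

theorem InvLimit.shift_iterate_apply {X : Type*} {f : X → X} (x : InvLimit f) (m : ℕ) (k : ℤ) :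
    ((InvLimit.shift f)^[m] x).1 k = x.1 (k + m) := by
  induction m generalizing k with
  | zero => simp
  | succ m ih =>
    rw [iterate_succ_apply']
    change ((InvLimit.shift f)^[m] x).1 (k + 1) = _
    rw [ih, Nat.cast_succ, add_assoc, add_comm 1]

/-- For every nonempty open `A ⊆ X_f` there are `m ∈ ℕ` and a nonempty open `V ⊆ X`
with `π^{-1}(V) ⊆ f̃^{-m}(A)`. -/
theorem stmt6 {X : Type*} [MetricSpace X] [CompactSpace X] [Nonempty X]
    (f : X → X) (hf : Continuous f) (hsurj : Function.Surjective f)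
    (A : Set (InvLimit f)) (hA : IsOpen A) (hAne : A.Nonempty) :
    ∃ (m : ℕ) (V : Set X), IsOpen V ∧ V.Nonempty ∧
      InvLimit.proj f ⁻¹' V ⊆ (InvLimit.shift f)^[m] ⁻¹' A := by
  obtain ⟨a, ha⟩ := hAne
  obtain ⟨B, hB, rfl⟩ := isOpen_induced_iff.1 hA
  obtain ⟨I, U, hU, hUB⟩ := isOpen_pi_iff.1 hB a.1 ha
  obtain ⟨m, hm⟩ : ∃ m : ℕ, ∀ k ∈ I, 0 ≤ k + (m : ℤ) := by
    refine ⟨I.sup Int.natAbs, fun k hk => ?_⟩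
    have := Finset.le_sup (f := Int.natAbs) hk
    omega
  refine ⟨m, ⋂ k ∈ I, f^[(k + (m : ℤ)).toNat] ⁻¹' U k, ?_, ⟨a.1 (-m), ?_⟩, fun x hx => ?_⟩
  · exact isOpen_biInter_finset fun k hk => (hU k hk).1.preimage (hf.iterate _)
  · refine mem_iInter₂.2 fun k hk => ?_
    rw [mem_preimage, InvLimit.iterate_apply, Int.toNat_of_nonneg (hm k hk),
      neg_add_cancel_comm_assoc]
    exact (hU k hk).2
  · refine hUB fun k hk => ?_
    have h := mem_iInter₂.1 hx k hk
    rw [mem_preimage, InvLimit.proj, InvLimit.iterate_apply, Int.toNat_of_nonneg (hm k hk),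
      zero_add] at h
    rwa [InvLimit.shift_iterate_apply]
end

section
/- Let λ, ξ be real numbers with 0 < λ ≤ ξ and ξ ≥ 1. Let c : ℤ → ℝ be a nonnegative sequence such that c(n+1) ≤ e^{ξ} c(n) for all n ∈ ℤ, c(0) > 0, and such that the series L(0)² = Σ_{j=0}^{∞} c(−j)² e^{2λ j} converges. Then for every integer n ≥ 1 the series L(n)² = Σ_{j=0}^{∞} c(n−j)² e^{2λ j} converges and satisfies e^{2λ n} L(0)² ≤ L(n)² ≤ e^{7 ξ n} L(0)². -/
/-- The squared Lyapunov norm `L(m)² = Σ_j c(m-j)² e^{2λj}` satisfies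
`L(m+1)² = e^{2λ} L(m)² + c(m+1)²`. -/
lemma hasSum_lyapunov_succ {lam L : ℝ} {c : ℤ → ℝ} {m : ℤ}
    (h : HasSum (fun j : ℕ => (c (m - (j : ℤ))) ^ 2 * Real.exp (2 * lam * j)) L) :
    HasSum (fun j : ℕ => (c (m + 1 - (j : ℤ))) ^ 2 * Real.exp (2 * lam * j))
      (Real.exp (2 * lam) * L + c (m + 1) ^ 2) := by
  rw [← hasSum_nat_add_iff' 1]
  convert h.mul_left (Real.exp (2 * lam)) using 1
  · rfl
  · funext j
    have hidx : m + 1 - ((j + 1 : ℕ) : ℤ) = m - j := by push_cast; ring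
    have hexp : 2 * lam * ((j + 1 : ℕ) : ℝ) = 2 * lam + 2 * lam * j := by push_cast; ring
    rw [hidx, hexp, Real.exp_add]
    ring
  · simp

/-- If `0 ≤ c(n+1) ≤ e^ξ c(n)` for all `n`, then `L(m+1)² ≤ e^{2ξ} L(m)²`. -/
lemma lyapunov_succ_le {lam ξ L L' : ℝ} {c : ℤ → ℝ} {m : ℤ} (hc₀ : ∀ n : ℤ, 0 ≤ c n)
    (hstep : ∀ n : ℤ, c (n + 1) ≤ Real.exp ξ * c n)
    (h : HasSum (fun j : ℕ => (c (m - (j : ℤ))) ^ 2 * Real.exp (2 * lam * j)) L)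
    (h' : HasSum (fun j : ℕ => (c (m + 1 - (j : ℤ))) ^ 2 * Real.exp (2 * lam * j)) L') :
    L' ≤ Real.exp (2 * ξ) * L := by
  refine hasSum_le (fun j => ?_) h' (h.mul_left _)
  rw [← mul_assoc, add_sub_right_comm]
  gcongr
  calc c (m - j + 1) ^ 2 ≤ (Real.exp ξ * c (m - j)) ^ 2 :=
        pow_le_pow_left₀ (hc₀ _) (hstep _) 2
    _ = Real.exp (2 * ξ) * c (m - j) ^ 2 := by
        rw [mul_pow, ← Real.exp_nat_mul, Nat.cast_ofNat]

/-- Growth estimate for the Lyapunov norm: if `c(n+1) ≤ e^ξ c(n)`, `c ≥ 0`, `c(0) > 0`,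
and `L(0)² = Σ_j c(-j)² e^{2λj}` converges, then for every `n ≥ 1` the series
`L(n)² = Σ_j c(n-j)² e^{2λj}` converges and `e^{2λn} L(0)² ≤ L(n)² ≤ e^{7ξn} L(0)²`. -/
theorem stmt12 (lam ξ : ℝ) (hlam : 0 < lam) (hlamξ : lam ≤ ξ) (hξ : 1 ≤ ξ)
    (c : ℤ → ℝ) (hc₀ : ∀ n : ℤ, 0 ≤ c n) (hcpos : 0 < c 0)
    (hstep : ∀ n : ℤ, c (n + 1) ≤ Real.exp ξ * c n)
    (L0 : ℝ) (hL0 : HasSum (fun j : ℕ => (c (-(j : ℤ))) ^ 2 * Real.exp (2 * lam * j)) L0) :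
    ∀ n : ℕ, 1 ≤ n → ∃ Ln : ℝ,
      HasSum (fun j : ℕ => (c ((n : ℤ) - (j : ℤ))) ^ 2 * Real.exp (2 * lam * j)) Ln ∧
      Real.exp (2 * lam * n) * L0 ≤ Ln ∧ Ln ≤ Real.exp (7 * ξ * n) * L0 := by
  intro n _
  have hL0_nonneg : 0 ≤ L0 := hL0.nonneg fun j => by positivity
  suffices h : ∃ Ln : ℝ,
      HasSum (fun j : ℕ => (c ((n : ℤ) - (j : ℤ))) ^ 2 * Real.exp (2 * lam * j)) Ln ∧
      Real.exp (2 * lam * n) * L0 ≤ Ln ∧ Ln ≤ Real.exp (2 * ξ * n) * L0 by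
    obtain ⟨Ln, hsum, hlow, hup⟩ := h
    refine ⟨Ln, hsum, hlow, hup.trans ?_⟩
    gcongr
    norm_num
  clear * - hc₀ hstep hL0
  induction n with
  | zero => exact ⟨L0, by simpa using hL0, by simp, by simp⟩
  | succ n ih =>
    obtain ⟨Ln, hsum, hlow, hup⟩ := ih
    have hsum' := hasSum_lyapunov_succ hsum
    have hexp (a : ℝ) : Real.exp (a * (n + 1 : ℕ)) * L0 =
        Real.exp a * (Real.exp (a * n) * L0) := by
      rw [← mul_assoc, ← Real.exp_add]
      push_cast
      ring_nf
    refine ⟨_, by exact_mod_cast hsum', ?_, ?_⟩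
    · rw [hexp]
      exact le_add_of_le_of_nonneg (by gcongr) (sq_nonneg _)
    · rw [hexp]
      exact (lyapunov_succ_le hc₀ hstep hsum hsum').trans (by gcongr)
end

section
/- Let λ, σ, χ₁, χ₂ be real numbers with 0 < λ ≤ σ and χ₁ ≤ χ₂ < 0, and let ε be a real number with 0 < ε < e^{-σ}. Let A, B : ℕ → ℝ be strictly positive sequences with A(0) = B(0) = 1, e^{λ} A(k) ≤ A(k+1) ≤ e^{σ} A(k) and e^{λ} B(k) ≤ B(k+1) ≤ e^{σ} B(k) for all k ∈ ℕ. Let D : ℕ → ℝ be strictly positive with D(n) < ε for all n and e^{χ₁ (m−n)} D(n) ≤ D(m) ≤ e^{χ₂ (m−n)} D(n) for all m ≥ n. Define τ(n) as the least k ∈ ℕ with A(k) · D(n) ≥ ε, and t(n) as the least k ∈ ℕ with B(k) ≥ A(τ(n)) (both are well defined). Then there exist constants Θ ≥ 1 and A₀ ≥ 0 depending only on λ, σ, χ₁, χ₂ such that for all m, n ∈ ℕ: Θ^{-1} |m − n| − A₀ ≤ |τ(m) − τ(n)| ≤ Θ |m − n| + A₀ and Θ^{-1} |m − n| − A₀ ≤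 |t(m) − t(n)| ≤ Θ |m − n| + A₀. -/
/-- The stopping time `τ(n)`: the least `k ∈ ℕ` with `A(k) · D(n) ≥ ε`. -/
noncomputable def tauStop (ε : ℝ) (A D : ℕ → ℝ) (n : ℕ) : ℕ :=
  sInf {k : ℕ | ε ≤ A k * D n}

/-- The stopping time `t(n)`: the least `k ∈ ℕ` with `B(k) ≥ A(τ(n))`. -/
noncomputable def tStop (ε : ℝ) (A B D : ℕ → ℝ) (n : ℕ) : ℕ :=
  sInf {k : ℕ | A (tauStop ε A D n) ≤ B k}

/-- A sequence whose increments lie in `[lam, σ]` is bi-Lipschitz. -/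
theorem abs_sub_mem_Icc_of_increments {lam σ : ℝ} (hlam : 0 < lam) {a : ℕ → ℝ}
    (hlow : ∀ k, lam + a k ≤ a (k + 1)) (hup : ∀ k, a (k + 1) ≤ σ + a k) (k l : ℕ) :
    |a k - a l| ∈ Set.Icc (lam * |(k : ℝ) - l|) (σ * |(k : ℝ) - l|) := by
  wlog h : l ≤ k generalizing k l
  · rw [abs_sub_comm (a k), abs_sub_comm (k : ℝ)]
    exact this l k (by omega)
  have key : lam * ((k : ℝ) - l) ≤ a k - a l ∧ a k - a l ≤ σ * ((k : ℝ) - l) := by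
    induction k, h using Nat.le_induction with
    | base => simp
    | succ k _ ih =>
      have h₁ := hlow k
      have h₂ := hup k
      push_cast
      constructor <;> linarith [ih.1, ih.2]
  have hkl : (0 : ℝ) ≤ (k : ℝ) - l := sub_nonneg.2 (by exact_mod_cast h)
  rw [abs_of_nonneg hkl, abs_of_nonneg ((mul_nonneg hlam.le hkl).trans key.1)]
  exact key

/-- A sequence growing at least by the factor `e^lam > 1` at each step is unbounded. -/
theorem exists_le_of_exp_growth {lam : ℝ} (hlam : 0 < lam) {F : ℕ → ℝ} (h0 : F 0 = 1)
    (hlow : ∀ k, Real.exp lam * F k ≤ F (k + 1)) (u : ℝ) : ∃ k, u ≤ F k := by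
  obtain ⟨k, hk⟩ := pow_unbounded_of_one_lt u (Real.one_lt_exp_iff.2 hlam)
  have hpow : ∀ k, Real.exp lam ^ k ≤ F k := by
    intro k
    induction k with
    | zero => simp [h0]
    | succ k ih =>
      rw [pow_succ']
      exact (mul_le_mul_of_nonneg_left ih (Real.exp_pos _).le).trans (hlow k)
  exact ⟨k, hk.le.trans (hpow k)⟩

/-- At the first time a sequence passes the level `u ≥ 1`, it overshoots by at most `e^σ`;
stated for logarithms. -/
theorem log_sInf_mem_Icc {σ : ℝ} (hσ : 0 ≤ σ) {F : ℕ → ℝ} (hF : ∀ k, 0 < F k) (h0 : F 0 = 1)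
    (hup : ∀ k, F (k + 1) ≤ Real.exp σ * F k) {u : ℝ} (hu : 1 ≤ u)
    (hne : {k : ℕ | u ≤ F k}.Nonempty) :
    Real.log (F (sInf {k : ℕ | u ≤ F k})) ∈ Set.Icc (Real.log u) (Real.log u + σ) := by
  have hu0 : 0 < u := by linarith
  refine ⟨Real.log_le_log hu0 (Nat.sInf_mem hne), ?_⟩
  rcases hk : sInf {k : ℕ | u ≤ F k} with _ | k
  · rw [h0, Real.log_one]
    exact add_nonneg (Real.log_nonneg hu) hσ
  · have hlt : F k < u := by
      have := Nat.notMem_of_lt_sInf (s := {k : ℕ | u ≤ F k}) (m := k) (by omega)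
      simpa using this
    have hle : F (k + 1) ≤ Real.exp σ * u :=
      (hup k).trans (mul_le_mul_of_nonneg_left hlt.le (Real.exp_pos _).le)
    have := Real.log_le_log (hF _) hle
    rwa [Real.log_mul (Real.exp_pos _).ne' hu0.ne', Real.log_exp, add_comm σ] at this

/-- If the increments of `log F` lie in `[lam, σ]`, the levels `u` are bi-Lipschitz with constants
`c₂ ≤ c₁`, and `log F` at the time `K n` is within `2σ` above `u n`, then `K` is a
quasi-isometric embedding. -/
theorem quasiIsometric_of_log_mem_Icc {lam σ c₁ c₂ : ℝ} (hlam : 0 < lam) (hlamσ : lam ≤ σ)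
    (hc₁ : 0 < c₁) (hc₂ : 0 < c₂) {F : ℕ → ℝ} (hF : ∀ k, 0 < F k)
    (hlow : ∀ k, Real.exp lam * F k ≤ F (k + 1)) (hup : ∀ k, F (k + 1) ≤ Real.exp σ * F k)
    {u : ℕ → ℝ} {K : ℕ → ℕ}
    (hu : ∀ m n : ℕ, |u m - u n| ∈ Set.Icc (c₂ * |(m : ℝ) - n|) (c₁ * |(m : ℝ) - n|))
    (hK : ∀ n, Real.log (F (K n)) ∈ Set.Icc (u n) (u n + 2 * σ)) (m n : ℕ) :
    (1 + c₁ / lam + σ / c₂)⁻¹ * |(m : ℝ) - n| - 2 * σ / lam ≤ |(K m : ℝ) - K n| ∧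
      |(K m : ℝ) - K n| ≤ (1 + c₁ / lam + σ / c₂) * |(m : ℝ) - n| + 2 * σ / lam := by
  have hσ : 0 < σ := hlam.trans_le hlamσ
  have hlog₁ : ∀ k, lam + Real.log (F k) ≤ Real.log (F (k + 1)) := fun k => by
    have := Real.log_le_log (mul_pos (Real.exp_pos _) (hF k)) (hlow k)
    rwa [Real.log_mul (Real.exp_pos _).ne' (hF k).ne', Real.log_exp] at this
  have hlog₂ : ∀ k, Real.log (F (k + 1)) ≤ σ + Real.log (F k) := fun k => by
    have := Real.log_le_log (hF _) (hup k)
    rwa [Real.log_mul (Real.exp_pos _).ne' (hF k).ne', Real.log_exp] at this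
  obtain ⟨hKlow, hKup⟩ :=
    abs_sub_mem_Icc_of_increments (a := fun k => Real.log (F k)) hlam hlog₁ hlog₂ (K m) (K n)
  obtain ⟨hulow, huup⟩ := hu m n
  obtain ⟨hm₁, hm₂⟩ := hK m
  obtain ⟨hn₁, hn₂⟩ := hK n
  have hdist : |(Real.log (F (K m)) - Real.log (F (K n))) - (u m - u n)| ≤ 2 * σ :=
    abs_le.2 ⟨by linarith, by linarith⟩
  have hcmp := abs_le.1 ((abs_abs_sub_abs_le_abs_sub _ _).trans hdist)
  have hx : 0 ≤ |(m : ℝ) - n| := abs_nonneg _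
  generalize |(m : ℝ) - n| = x at *
  generalize |(K m : ℝ) - K n| = y at *
  have hq₁ : 0 < c₁ / lam := div_pos hc₁ hlam
  have hq₂ : 0 < σ / c₂ := div_pos hσ hc₂
  constructor
  · have hinv : (1 + c₁ / lam + σ / c₂)⁻¹ ≤ c₂ / σ := by
      rw [← inv_div σ c₂]
      exact inv_anti₀ hq₂ (by linarith)
    have hratio : 2 ≤ 2 * σ / lam := by
      rw [le_div_iff₀ hlam]
      linarith
    have hy : c₂ / σ * x ≤ y + 2 := by
      rw [div_mul_eq_mul_div, div_le_iff₀ hσ]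
      linarith [hcmp.1]
    linarith [mul_le_mul_of_nonneg_right hinv hx]
  · have hy : y ≤ c₁ / lam * x + 2 * σ / lam := by
      rw [div_mul_eq_mul_div, ← add_div, le_div_iff₀ hlam]
      linarith [hcmp.2]
    linarith [mul_nonneg hq₂.le hx]

/-- Quasi-isometric estimate for the stopping times: there are `Θ ≥ 1` and `A₀ ≥ 0`,
depending only on `λ, σ, χ₁, χ₂`, such that for any admissible data `ε, A, B, D`, the
stopping times `τ` and `t` are well defined and quasi-isometric. -/
theorem stmt13 (lam σ χ₁ χ₂ : ℝ)
    (hlam : 0 < lam) (hlamσ : lam ≤ σ) (hχ₁₂ : χ₁ ≤ χ₂) (hχ₂ : χ₂ < 0) :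
    ∃ Θ A₀ : ℝ, 1 ≤ Θ ∧ 0 ≤ A₀ ∧
      ∀ (ε : ℝ), 0 < ε → ε < Real.exp (-σ) →
      ∀ (A B D : ℕ → ℝ),
        (∀ k, 0 < A k) → A 0 = 1 →
        (∀ k, Real.exp lam * A k ≤ A (k + 1)) → (∀ k, A (k + 1) ≤ Real.exp σ * A k) →
        (∀ k, 0 < B k) → B 0 = 1 →
        (∀ k, Real.exp lam * B k ≤ B (k + 1)) → (∀ k, B (k + 1) ≤ Real.exp σ * B k) →
        (∀ n, 0 < D n) → (∀ n, D n < ε) →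
        (∀ m n : ℕ, n ≤ m →
          Real.exp (χ₁ * ((m : ℝ) - n)) * D n ≤ D m ∧
            D m ≤ Real.exp (χ₂ * ((m : ℝ) - n)) * D n) →
        (∀ n, {k : ℕ | ε ≤ A k * D n}.Nonempty) ∧
        (∀ n, {k : ℕ | A (tauStop ε A D n) ≤ B k}.Nonempty) ∧
        (∀ m n : ℕ,
          (Θ⁻¹ * |(m : ℝ) - n| - A₀ ≤ |(tauStop ε A D m : ℝ) - tauStop ε A D n| ∧
            |(tauStop ε A D m : ℝ) - tauStop ε A D n| ≤ Θ * |(m : ℝ) - n| + A₀) ∧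
          (Θ⁻¹ * |(m : ℝ) - n| - A₀ ≤ |(tStop ε A B D m : ℝ) - tStop ε A B D n| ∧
            |(tStop ε A B D m : ℝ) - tStop ε A B D n| ≤ Θ * |(m : ℝ) - n| + A₀)) := by
  refine ⟨1 + -χ₁ / lam + σ / -χ₂, 2 * σ / lam, ?_, ?_, ?_⟩
  · have h₁ : 0 ≤ -χ₁ / lam := div_nonneg (by linarith) hlam.le
    have h₂ : 0 ≤ σ / -χ₂ := div_nonneg (by linarith) (by linarith)
    linarith
  · exact div_nonneg (by linarith) hlam.le
  intro ε hε _ A B D hA hA0 hAlow hAup hB hB0 hBlow hBup hD hDε hDD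
  have hσ : 0 ≤ σ := by linarith
  have hset : ∀ n, {k : ℕ | ε ≤ A k * D n} = {k : ℕ | ε / D n ≤ A k} := fun n => by
    ext k
    simp [div_le_iff₀ (hD n)]
  have hneA : ∀ n, {k : ℕ | ε ≤ A k * D n}.Nonempty := fun n => by
    rw [hset]
    exact exists_le_of_exp_growth hlam hA0 hAlow _
  have hneB : ∀ n, {k : ℕ | A (tauStop ε A D n) ≤ B k}.Nonempty := fun n =>
    exists_le_of_exp_growth hlam hB0 hBlow _
  have hlevel : ∀ n, 1 ≤ ε / D n := fun n => (one_le_div (hD n)).2 (hDε n).le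
  have hτ : ∀ n, Real.log (A (tauStop ε A D n)) ∈
      Set.Icc (Real.log (ε / D n)) (Real.log (ε / D n) + σ) := fun n => by
    have hne := hneA n
    rw [hset] at hne
    rw [tauStop, hset]
    exact log_sInf_mem_Icc hσ hA hA0 hAup (hlevel n) hne
  have hAτ : ∀ n, 1 ≤ A (tauStop ε A D n) := fun n =>
    (Real.log_nonneg_iff (hA _)).1 ((Real.log_nonneg (hlevel n)).trans (hτ n).1)
  have ht : ∀ n, Real.log (B (tStop ε A B D n)) ∈
      Set.Icc (Real.log (A (tauStop ε A D n))) (Real.log (A (tauStop ε A D n)) + σ) := fun n =>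
    log_sInf_mem_Icc hσ hB hB0 hBup (hAτ n) (hneB n)
  have hlogD : ∀ n, Real.log (ε / D n) = Real.log ε - Real.log (D n) := fun n =>
    Real.log_div hε.ne' (hD n).ne'
  have hstep : ∀ k : ℕ, -χ₂ + Real.log (ε / D k) ≤ Real.log (ε / D (k + 1)) ∧
      Real.log (ε / D (k + 1)) ≤ -χ₁ + Real.log (ε / D k) := fun k => by
    obtain ⟨h₁, h₂⟩ := hDD (k + 1) k k.le_succ
    have h₁' := Real.log_le_log (mul_pos (Real.exp_pos _) (hD k)) h₁
    have h₂' := Real.log_le_log (hD _) h₂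
    rw [Real.log_mul (Real.exp_pos _).ne' (hD k).ne', Real.log_exp] at h₁' h₂'
    push_cast at h₁' h₂'
    rw [hlogD, hlogD]
    constructor <;> linarith
  have hu : ∀ m n : ℕ, |Real.log (ε / D m) - Real.log (ε / D n)| ∈
      Set.Icc (-χ₂ * |(m : ℝ) - n|) (-χ₁ * |(m : ℝ) - n|) :=
    abs_sub_mem_Icc_of_increments (a := fun n => Real.log (ε / D n)) (by linarith)
      (fun k => (hstep k).1) (fun k => (hstep k).2)
  refine ⟨hneA, hneB, fun m n => ⟨?_, ?_⟩⟩
  · exact quasiIsometric_of_log_mem_Icc hlam hlamσ (by linarith) (by linarith) hA hAlow hAup hu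
      (fun n => ⟨(hτ n).1, by linarith [(hτ n).2]⟩) m n
  · exact quasiIsometric_of_log_mem_Icc hlam hlamσ (by linarith) (by linarith) hB hBlow hBup hu
      (fun n => ⟨(hτ n).1.trans (ht n).1, by linarith [(hτ n).2, (ht n).2]⟩) m n
end

section
/- Let Δ > 1, m ∈ ℕ with m ≥ 1, and η₁, η₂ ∈ (0,1) satisfy 1 − η₁ > 1/2 and Δ · m · η₂ < 1/2. Let (X, ν) and (Y, ν̂) be probability spaces, and let J₁, …, J_k ⊆ X and Ĵ₁, …, Ĵ_k ⊆ Y be measurable sets such that: (1) X = J₁ ∪ ⋯ ∪ J_k and Y = Ĵ₁ ∪ ⋯ ∪ Ĵ_k; (2) every y ∈ Y belongs to at most m of the sets Ĵ₁, …, Ĵ_k; (3) Δ^{-1} ν̂(Ĵ_i) ≤ ν(J_i) ≤ Δ ν̂(Ĵ_i) for every i. Suppose Q ⊆ X and Q̂ ⊆ Y are measurable sets with ν(Q) > 1 − η₁ and ν̂(Q̂) > 1 − η₂. Then there exists i ∈ {1, …, k} such that J_i ∩ Q ≠ ∅ and Ĵ_i ∩ Q̂ ≠ ∅. -/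
open MeasureTheory Set

/-- If finitely many measurable subsets of `t` cover every point at most `m` times, then their
measures sum to at most `m * μ t`. -/
theorem sum_measure_le_mul_of_ncard_le {α ι : Type*} [MeasurableSpace α] (μ : Measure α)
    (s : Finset ι) (A : ι → Set α) (t : Set α) (m : ℕ) (hA : ∀ i ∈ s, MeasurableSet (A i))
    (hAt : ∀ i ∈ s, A i ⊆ t) (hm : ∀ x, {i | i ∈ s ∧ x ∈ A i}.ncard ≤ m) :
    ∑ i ∈ s, μ (A i) ≤ m * μ t := by
  classical
  calc ∑ i ∈ s, μ (A i) = ∑ i ∈ s, ∫⁻ x in t, (A i).indicator 1 x ∂μ := by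
        refine Finset.sum_congr rfl fun i hi => ?_
        rw [lintegral_indicator_one (hA i hi), Measure.restrict_apply (hA i hi),
          inter_eq_left.2 (hAt i hi)]
    _ = ∫⁻ x in t, ∑ i ∈ s, (A i).indicator 1 x ∂μ :=
        (lintegral_finsetSum' s fun i hi => (measurable_one.indicator (hA i hi)).aemeasurable).symm
    _ ≤ ∫⁻ _ in t, m ∂μ := by
        refine lintegral_mono fun x => ?_
        have hx := hm x
        rw [← Finset.coe_filter, ncard_coe_finset] at hx
        simpa [indicator_apply, Finset.sum_boole] using hx
    _ = m * μ t := setLIntegral_const t _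

/-- The Eskin–Mirzakhani combinatorial lemma: given two probability spaces covered by
finitely many comparable measurable pieces with bounded overlap on the second side,
and large-measure sets `Q`, `Q̂`, some piece meets `Q` on the first side and the
corresponding piece meets `Q̂` on the second side. -/
theorem stmt14 {X Y : Type*} [MeasurableSpace X] [MeasurableSpace Y]
    (ν : Measure X) (νh : Measure Y) [IsProbabilityMeasure ν] [IsProbabilityMeasure νh]
    (Δ : ℝ) (hΔ : 1 < Δ) (m : ℕ) (hm : 1 ≤ m)
    (η₁ η₂ : ℝ) (hη₁ : 0 < η₁) (hη₁' : η₁ < 1) (hη₂ : 0 < η₂) (hη₂' : η₂ < 1)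
    (hhalf : 1 / 2 < 1 - η₁) (hsmall : Δ * m * η₂ < 1 / 2)
    (k : ℕ) (J : Fin k → Set X) (Jh : Fin k → Set Y)
    (hJmeas : ∀ i, MeasurableSet (J i)) (hJhmeas : ∀ i, MeasurableSet (Jh i))
    (hXcov : (⋃ i, J i) = Set.univ) (hYcov : (⋃ i, Jh i) = Set.univ)
    (hmult : ∀ y : Y, {i : Fin k | y ∈ Jh i}.ncard ≤ m)
    (hcomp : ∀ i, Δ⁻¹ * (νh (Jh i)).toReal ≤ (ν (J i)).toReal ∧
      (ν (J i)).toReal ≤ Δ * (νh (Jh i)).toReal)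
    (Q : Set X) (Qh : Set Y) (hQmeas : MeasurableSet Q) (hQhmeas : MeasurableSet Qh)
    (hQ : 1 - η₁ < (ν Q).toReal) (hQh : 1 - η₂ < (νh Qh).toReal) :
    ∃ i : Fin k, (J i ∩ Q).Nonempty ∧ (Jh i ∩ Qh).Nonempty := by
  classical
  by_contra! h
  set S : Finset (Fin k) := Finset.univ.filter fun i => (J i ∩ Q).Nonempty with hS
  have hQS : Q ⊆ ⋃ i ∈ S, J i := fun x hx => by
    obtain ⟨i, hi⟩ := mem_iUnion.1 (hXcov.symm ▸ mem_univ x)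
    exact mem_biUnion (show i ∈ S by simpa [hS] using ⟨x, hi, hx⟩) hi
  have hQ_le : ν.real Q ≤ ∑ i ∈ S, ν.real (J i) :=
    (measureReal_mono hQS (measure_ne_top ν _)).trans (measureReal_biUnion_finset_le S J)
  have hsub : ∀ i ∈ S, Jh i ⊆ Qhᶜ := fun i hi y hy hyQ => by
    have := h i (by simpa [hS] using hi)
    exact this.subset ⟨hy, hyQ⟩
  have hsum := sum_measure_le_mul_of_ncard_le νh S Jh Qhᶜ m (fun i _ => hJhmeas i) hsub
    fun y => (ncard_le_ncard (fun i hi => hi.2) (toFinite _)).trans (hmult y)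
  have hsum_real : ∑ i ∈ S, νh.real (Jh i) ≤ m * νh.real Qhᶜ := by
    have := ENNReal.toReal_mono (by finiteness) hsum
    rwa [ENNReal.toReal_sum fun i _ => by finiteness, ENNReal.toReal_mul,
      ENNReal.toReal_natCast] at this
  have hcompl : νh.real Qhᶜ ≤ η₂ := by
    rw [probReal_compl_eq_one_sub hQhmeas]
    change 1 - η₂ < νh.real Qh at hQh
    linarith
  have hlt : ν.real Q < 1 / 2 :=
    calc ν.real Q ≤ ∑ i ∈ S, Δ * νh.real (Jh i) :=
          hQ_le.trans (Finset.sum_le_sum fun i _ => (hcomp i).2)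
      _ = Δ * ∑ i ∈ S, νh.real (Jh i) := Finset.mul_sum .. |>.symm
      _ ≤ Δ * (m * η₂) := by
          gcongr
          exact hsum_real.trans (by gcongr)
      _ < 1 / 2 := by rwa [← mul_assoc]
  exact absurd (hhalf.trans hQ) hlt.not_gt
end
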